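/- Position equivariance of the full iterated SE-RRM recurrence: fix an initial state Z⁰ : Fin D → Fin I → Fin K → ℝ that is constant along the position index (Z⁰ d i k = Z⁰ d i' k for all i, i'), and define the recurrence Zstate 0 X = Z⁰ and Zstate (t+1) X = SBlockL (E X + Zstate t X). Then for every t : ℕ, every X : Fin I → Fin K, and every σ : Equiv.Perm (Fin I), Zstate t (fun i => X (σ i)) = PosT σ (Zstate t X). -/

import Mathlib

open Matrix BigOperators

noncomputable def softmax {n : ℕ} (x : Fin n → ℝ) : Fin n → ℝ :=
  fun i => Real.exp (x i) / ∑ j, Real.exp (x j)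

noncomputable def Attn {D n : ℕ} (Wq Wk Wv : Matrix (Fin D) (Fin D) ℝ)
    (H : Matrix (Fin D) (Fin n) ℝ) : Matrix (Fin D) (Fin n) ℝ :=
  fun d j =>
    ∑ i, (softmax (fun i' =>
        dotProduct (Wq.mulVec (fun d => H d j)) (Wk.mulVec (fun d => H d i')))) i *
      (Wv.mulVec (fun d' => H d' i)) d

def PosT {D I K : ℕ} (σ : Equiv.Perm (Fin I)) (Z : Fin D → Fin I → Fin K → ℝ) :
    Fin D → Fin I → Fin K → ℝ :=
  fun d i k => Z d (σ i) k

def SymT {D I K : ℕ} (ρ : Equiv.Perm (Fin K)) (Z : Fin D → Fin I → Fin K → ℝ) :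
    Fin D → Fin I → Fin K → ℝ :=
  fun d i k => Z d i (ρ k)

noncomputable def TI {D I K : ℕ} (Wq Wk Wv : Matrix (Fin D) (Fin D) ℝ)
    (Z : Fin D → Fin I → Fin K → ℝ) : Fin D → Fin I → Fin K → ℝ :=
  fun d i k => (Attn Wq Wk Wv (fun d' i' => Z d' i' k)) d i

noncomputable def TK {D I K : ℕ} (Wq Wk Wv : Matrix (Fin D) (Fin D) ℝ)
    (Z : Fin D → Fin I → Fin K → ℝ) : Fin D → Fin I → Fin K → ℝ :=
  fun d i k => (Attn Wq Wk Wv (fun d' k' => Z d' i k')) d k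

def FiberT {D I K : ℕ} (g : (Fin D → ℝ) → (Fin D → ℝ))
    (Z : Fin D → Fin I → Fin K → ℝ) : Fin D → Fin I → Fin K → ℝ :=
  fun d i k => g (fun d' => Z d' i k) d

noncomputable def SLayer {D I K : ℕ} (Wq Wk Wv Wq' Wk' Wv' : Matrix (Fin D) (Fin D) ℝ)
    (norm m : (Fin D → ℝ) → (Fin D → ℝ))
    (Z : Fin D → Fin I → Fin K → ℝ) : Fin D → Fin I → Fin K → ℝ :=
  let Z' := FiberT norm (Z + TI Wq Wk Wv Z)
  let Z'' := FiberT norm (Z' + TK Wq' Wk' Wv' Z')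
  FiberT norm (Z'' + FiberT m Z'')

noncomputable def SBlock {D I K : ℕ} (Wq Wk Wv Wq' Wk' Wv' : Matrix (Fin D) (Fin D) ℝ)
    (norm m : (Fin D → ℝ) → (Fin D → ℝ)) (L : ℕ) :
    (Fin D → Fin I → Fin K → ℝ) → (Fin D → Fin I → Fin K → ℝ) :=
  (SLayer Wq Wk Wv Wq' Wk' Wv' norm m)^[L]

noncomputable def Emb {D I K : ℕ} (d₀ : Fin D → ℝ) (X : Fin I → Fin K) :
    Fin D → Fin I → Fin K → ℝ :=
  fun a i k => if X i = k then d₀ a else 0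

/-- Iterated SE-RRM recurrence: `Zstate 0 X = Z⁰`, `Zstate (t+1) X = SBlockL (E X + Zstate t X)`. -/
noncomputable def Zstate {D I K : ℕ} (Wq Wk Wv Wq' Wk' Wv' : Matrix (Fin D) (Fin D) ℝ)
    (norm m : (Fin D → ℝ) → (Fin D → ℝ)) (L : ℕ) (d₀ : Fin D → ℝ)
    (Z0 : Fin D → Fin I → Fin K → ℝ) :
    ℕ → (Fin I → Fin K) → (Fin D → Fin I → Fin K → ℝ)
  | 0, _ => Z0
  | t + 1, X =>
      SBlock Wq Wk Wv Wq' Wk' Wv' norm m L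
        (Emb d₀ X + Zstate Wq Wk Wv Wq' Wk' Wv' norm m L d₀ Z0 t X)

theorem softmax_comp_perm {n : ℕ} (σ : Equiv.Perm (Fin n)) (x : Fin n → ℝ) (i : Fin n) :
    softmax (fun j => x (σ j)) i = softmax x (σ i) := by
  unfold softmax
  rw [Equiv.sum_comp σ (fun j => Real.exp (x j))]

theorem Attn_comp_perm {D n : ℕ} (Wq Wk Wv : Matrix (Fin D) (Fin D) ℝ)
    (σ : Equiv.Perm (Fin n)) (H : Matrix (Fin D) (Fin n) ℝ) (d : Fin D) (j : Fin n) :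
    Attn Wq Wk Wv (fun d' i => H d' (σ i)) d j = Attn Wq Wk Wv H d (σ j) := by
  unfold Attn
  refine Eq.trans (Finset.sum_congr rfl fun i _ => ?_) (Equiv.sum_comp σ _)
  rw [← softmax_comp_perm]

theorem TI_PosT {D I K : ℕ} (Wq Wk Wv : Matrix (Fin D) (Fin D) ℝ)
    (σ : Equiv.Perm (Fin I)) (Z : Fin D → Fin I → Fin K → ℝ) :
    TI Wq Wk Wv (PosT σ Z) = PosT σ (TI Wq Wk Wv Z) := by
  funext d i k
  exact Attn_comp_perm Wq Wk Wv σ (fun d' i' => Z d' i' k) d i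

theorem SLayer_PosT {D I K : ℕ} (Wq Wk Wv Wq' Wk' Wv' : Matrix (Fin D) (Fin D) ℝ)
    (norm m : (Fin D → ℝ) → (Fin D → ℝ)) (σ : Equiv.Perm (Fin I))
    (Z : Fin D → Fin I → Fin K → ℝ) :
    SLayer Wq Wk Wv Wq' Wk' Wv' norm m (PosT σ Z)
      = PosT σ (SLayer Wq Wk Wv Wq' Wk' Wv' norm m Z) := by
  unfold SLayer
  rw [TI_PosT]
  rfl

theorem SBlock_PosT {D I K : ℕ} (Wq Wk Wv Wq' Wk' Wv' : Matrix (Fin D) (Fin D) ℝ)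
    (norm m : (Fin D → ℝ) → (Fin D → ℝ)) (L : ℕ) (σ : Equiv.Perm (Fin I))
    (Z : Fin D → Fin I → Fin K → ℝ) :
    SBlock Wq Wk Wv Wq' Wk' Wv' norm m L (PosT σ Z)
      = PosT σ (SBlock Wq Wk Wv Wq' Wk' Wv' norm m L Z) :=
  Function.Commute.iterate_left (g := PosT σ)
    (SLayer_PosT Wq Wk Wv Wq' Wk' Wv' norm m σ) L Z

theorem serrm_recurrence_position_equivariant {D I K : ℕ}
    (Wq Wk Wv Wq' Wk' Wv' : Matrix (Fin D) (Fin D) ℝ)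
    (norm m : (Fin D → ℝ) → (Fin D → ℝ)) (L : ℕ) (d₀ : Fin D → ℝ)
    (Z0 : Fin D → Fin I → Fin K → ℝ)
    (hZ0 : ∀ d i i' k, Z0 d i k = Z0 d i' k) :
    ∀ (t : ℕ) (X : Fin I → Fin K) (σ : Equiv.Perm (Fin I)),
      Zstate Wq Wk Wv Wq' Wk' Wv' norm m L d₀ Z0 t (fun i => X (σ i))
        = PosT σ (Zstate Wq Wk Wv Wq' Wk' Wv' norm m L d₀ Z0 t X) := by
  intro t X σ
  induction t with
  | zero =>
    funext d i k
    exact hZ0 d i (σ i) k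
  | succ t ih =>
    simp only [Zstate]
    rw [ih, ← SBlock_PosT]
    rfl
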